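/- Let d be a positive integer, let Ω ⊆ ℝ^d be a locally compact set with nonempty interior, and let φ be a gauge with limsup_{r→0+} φ(r)/r < ∞. Then for a typical function f ∈ C(Ω), both the set {x ∈ Ω : lip_φ f(x) > 0} and the set {x ∈ Ω : lip_φ f(x) = ∞} have Hausdorff dimension equal to d−1 and lower packing dimension equal to d−1. -/

import Mathlib

open Filter Set Topology MeasureTheory
open scoped ENNReal NNReal

noncomputable section

/-- A gauge: nondecreasing on `[0,∞)`, right-continuous, `φ 0 = 0`, positive on `(0,∞)`. -/
def IsGauge (φ : ℝ → ℝ) : Prop :=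
  (∀ ⦃a b : ℝ⦄, 0 ≤ a → a ≤ b → φ a ≤ φ b) ∧
  (∀ a : ℝ, 0 ≤ a → ContinuousWithinAt φ (Set.Ici a) a) ∧
  φ 0 = 0 ∧ (∀ r : ℝ, 0 < r → 0 < φ r)

/-- `N_δ(E)`: the least number of sets of diameter at most `δ` needed to cover `E`. -/
def coverNum {X : Type*} [PseudoMetricSpace X] (δ : ℝ) (E : Set X) : ℝ≥0∞ :=
  ⨅ (n : ℕ) (_ : ∃ F : Fin n → Set X,
    (∀ i, EMetric.diam (F i) ≤ ENNReal.ofReal δ) ∧ E ⊆ ⋃ i, F i), (n : ℝ≥0∞)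

/-- `ν_0^ζ(E) = liminf_{δ→0+} N_δ(E)·ζ(δ)`. -/
def nu0 {X : Type*} [PseudoMetricSpace X] (ζ : ℝ → ℝ) (E : Set X) : ℝ≥0∞ :=
  Filter.liminf (fun δ : ℝ => coverNum δ E * ENNReal.ofReal (ζ δ)) (𝓝[>] (0:ℝ))

/-- The lower box-counting measure `ν^ζ`. -/
def lowerBoxMeasure {X : Type*} [PseudoMetricSpace X] (ζ : ℝ → ℝ) (E : Set X) : ℝ≥0∞ :=
  ⨅ (G : ℕ → Set X) (_ : E ⊆ ⋃ n, G n), ∑' n, nu0 ζ (G n)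

/-- The lower box dimension `lbdim E = liminf_{r→0+} log N_r(E)/|log r|`. -/
def lbdim {X : Type*} [PseudoMetricSpace X] (E : Set X) : EReal :=
  Filter.liminf (fun r : ℝ => ENNReal.log (coverNum r E) * ((|Real.log r|⁻¹ : ℝ) : EReal))
    (𝓝[>] (0:ℝ))

/-- The lower packing dimension. -/
def lpdim {X : Type*} [PseudoMetricSpace X] (E : Set X) : EReal :=
  ⨅ (G : ℕ → Set X) (_ : E ⊆ ⋃ n, G n), ⨆ n, lbdim (G n)

/-- The generalized lower scaled oscillation `lip_φ f`. -/
def lipGauge {X : Type*} [PseudoMetricSpace X] (φ : ℝ → ℝ) (f : X → ℝ) (x : X) : ℝ≥0∞ :=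
  Filter.liminf
    (fun r : ℝ => EMetric.diam (f '' Metric.closedBall x r) / ENNReal.ofReal (φ r))
    (𝓝[>] (0:ℝ))

/-- The upper scaled oscillation `Lip f`. -/
def LipGauge {X : Type*} [PseudoMetricSpace X] (φ : ℝ → ℝ) (f : X → ℝ) (x : X) : ℝ≥0∞ :=
  Filter.limsup
    (fun r : ℝ => EMetric.diam (f '' Metric.closedBall x r) / ENNReal.ofReal (φ r))
    (𝓝[>] (0:ℝ))

/-- The Hausdorff measure with gauge `ξ`. -/
def hausdorffGauge {X : Type*} [PseudoMetricSpace X] (ξ : ℝ → ℝ) (E : Set X) : ℝ≥0∞ :=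
  ⨆ (δ : ℝ) (_ : 0 < δ), ⨅ (G : ℕ → Set X) (_ : E ⊆ ⋃ n, G n)
    (_ : ∀ n, EMetric.diam (G n) ≤ ENNReal.ofReal δ),
    ∑' n, ENNReal.ofReal (ξ (EMetric.diam (G n)).toReal)

/-- A box in `ℝ^k`. -/
def IsBox {k : ℕ} (S : Set (EuclideanSpace ℝ (Fin k))) : Prop :=
  ∃ a b : Fin k → ℝ, S = {x | ∀ i, x i ∈ Set.Icc (a i) (b i)}

/-- A microscopic subset of `ℝ^k`. -/
def Microscopic {k : ℕ} (X : Set (EuclideanSpace ℝ (Fin k))) : Prop :=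
  ∀ ε : ℝ, 0 < ε → ∃ B : ℕ → Set (EuclideanSpace ℝ (Fin k)),
    (∀ n, IsBox (B n)) ∧ X ⊆ ⋃ n, B n ∧
    ∀ n, MeasureTheory.volume (B n) ≤ ENNReal.ofReal (ε ^ (n + 1))

/-- A microscopic subset of `ℝ`. -/
def MicroscopicR (E : Set ℝ) : Prop :=
  ∀ ε : ℝ, 0 < ε → ∃ I : ℕ → ℝ × ℝ,
    E ⊆ ⋃ n, Set.Icc (I n).1 (I n).2 ∧
    ∀ n, MeasureTheory.volume (Set.Icc (I n).1 (I n).2) ≤ ENNReal.ofReal (ε ^ (n + 1))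

end

/-- `h` is almost constant on each cell `[j s, j s + s - δ]`, for arbitrarily small `s`, where the
gap `δ` and the error are small relative to `s`. -/
def HasFlatCells (h : ℝ → ℝ) (α β : ℝ) : Prop :=
  ∀ ε : ℝ, 0 < ε → ∃ s δ : ℝ, 0 < s ∧ s ≤ ε ∧ 0 < δ ∧ δ ≤ ε * s ∧
    ∀ j : ℤ, ∀ x ∈ Icc α β, ∀ y ∈ Icc α β, x ∈ Icc (j * s) (j * s + s - δ) →
      y ∈ Icc (j * s) (j * s + s - δ) → |h x - h y| ≤ ε * s

/-- A point of `[A, B)` from which the increments to the right have slope at least `n`, obtained by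
minimising `h t - n t`. -/
lemma exists_steep_point {h : ℝ → ℝ} {A B n : ℝ} (hn : 0 ≤ n) (hAB : A ≤ B)
    (hc : ContinuousOn h (Icc A B)) (hs : n * (B - A) < h B - h A) :
    ∃ x, A ≤ x ∧ x < B ∧ (∀ y ∈ Icc x B, n * (y - x) ≤ h y - h x) ∧
      h B - h A - n * (B - A) ≤ h B - h x := by
  obtain ⟨x, hx, hmin⟩ := isCompact_Icc.exists_isMinOn (nonempty_Icc.2 hAB)
    (f := fun t => h t - n * t) (hc.sub (by fun_prop))
  have hmin' : ∀ y ∈ Icc A B, h x - n * x ≤ h y - n * y := fun y hy => hmin hy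
  have h1 := hmin' A ⟨le_rfl, hAB⟩
  have hxB : x < B := by
    refine lt_of_le_of_ne hx.2 ?_
    rintro rfl
    nlinarith
  refine ⟨x, hx.1, hxB, fun y hy => ?_, ?_⟩
  · have := hmin' y ⟨hx.1.trans hy.1, hy.2⟩
    linarith
  · nlinarith [hx.1, mul_nonneg hn (sub_nonneg.2 hxB.le)]

/-- `[x, b]` is a right neighbourhood of `x` in `[α, β]` on which `h` has slope at least `n`
from `x`. -/
def SteepFrom (h : ℝ → ℝ) (α β n x b : ℝ) : Prop :=
  α ≤ x ∧ x < b ∧ b ≤ β ∧ ∀ y ∈ Icc x b, n * (y - x) ≤ h y - h x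

lemma SteepFrom.exists_next {h : ℝ → ℝ} {α β : ℝ} (hc : ContinuousOn h (Icc α β))
    (hcell : HasFlatCells h α β) {n x b : ℝ} (hn : 1 ≤ n) (hx : SteepFrom h α β n x b)
    {n' ε : ℝ} (hn' : 1 ≤ n') (hε : 0 < ε) :
    ∃ x' b', SteepFrom h α β n' x' b' ∧ x ≤ x' ∧ b' ≤ b ∧ b' ≤ x + ε ∧
      ∀ z ∈ Icc x' b', ∀ r, b' - x' ≤ r → r ≤ b - x →
        ∃ u ∈ Icc α β, ∃ v ∈ Icc α β, |u - z| ≤ r ∧ |v - z| ≤ r ∧ n / 32 * r ≤ h v - h u := by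
  obtain ⟨hαx, hxb, hbβ, hsl⟩ := hx
  obtain ⟨s, δ, hs, hsε, hδ, hδs, hflat⟩ := hcell
    (min (min ε ((b - x) / 2)) (1 / (8 * n'))) (by
      refine lt_min (lt_min hε (by linarith)) (by positivity))
  set e := min (min ε ((b - x) / 2)) (1 / (8 * n')) with he
  have he1 : e ≤ ε := (min_le_left _ _).trans (min_le_left _ _)
  have he2 : e ≤ (b - x) / 2 := (min_le_left _ _).trans (min_le_right _ _)
  have he3 : e ≤ 1 / (8 * n') := min_le_right _ _
  have he4 : e ≤ 1 / 8 := he3.trans (by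
    apply one_div_le_one_div_of_le <;> linarith)
  have he5 : n' * e ≤ 1 / 8 := by
    calc n' * e ≤ n' * (1 / (8 * n')) := by gcongr
      _ = 1 / 8 := by field_simp
  have hes : e * s ≤ s / 8 := by nlinarith
  have hnδ : n' * δ ≤ s / 8 := by nlinarith
  set j : ℤ := ⌊x / s⌋ with hj
  have hj1 : j * s ≤ x := by
    have := Int.floor_le (x / s)
    rwa [le_div_iff₀ hs] at this
  have hj2 : x < j * s + s := by
    have := Int.lt_floor_add_one (x / s)
    rw [div_lt_iff₀ hs] at this
    linarith
  set p : ℝ := j * s + s with hp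
  have hcast : ((j + 1 : ℤ) : ℝ) * s = p := by push_cast; ring
  set A := max x (p - δ) with hA
  have hxA : x ≤ A := le_max_left _ _
  have hAp : A ≤ p := max_le hj2.le (by linarith)
  have hAδ : p - A ≤ δ := by linarith [le_max_right x (p - δ)]
  have hrise1 : h A - h x ≤ e * s := by
    rcases le_total x (p - δ) with h1 | h1
    · rw [hA, max_eq_right h1]
      exact (le_abs_self _).trans (hflat j _ ⟨by linarith, by linarith⟩ _ ⟨by linarith, by linarith⟩
        ⟨by linarith, by linarith⟩ ⟨by linarith, by linarith⟩)
    · rw [hA, max_eq_left h1, sub_self]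
      nlinarith
  have hrise2 : h (p + s - δ) - h p ≤ e * s := by
    refine (le_abs_self _).trans (hflat (j + 1) _ ⟨by linarith, by linarith⟩ _
      ⟨by linarith, by linarith⟩ ?_ ?_) <;> rw [hcast] <;> constructor <;> linarith
  have hrise3 : n * (s - δ) ≤ h (p + s - δ) - h x := by
    refine le_trans ?_ (hsl _ ⟨by linarith, by linarith⟩)
    exact mul_le_mul_of_nonneg_left (by linarith) (by linarith)
  have hδs' : n * δ ≤ n * (s / 8) := mul_le_mul_of_nonneg_left (by linarith) (by linarith)
  have hsn : s ≤ n * s := by nlinarith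
  have hjump : n * s / 4 ≤ h p - h A := by linarith
  have hmul : n' * (p - A) ≤ n' * δ := by gcongr
  obtain ⟨x', hx1, hx2, hx3, hx4⟩ := exists_steep_point (n := n') (by linarith) hAp
    (hc.mono (Icc_subset_Icc (by linarith) (by linarith))) (by linarith)
  have hbig : n * s / 8 ≤ h p - h x' := by linarith
  refine ⟨x', p, ⟨by linarith, hx2, by linarith, hx3⟩, by linarith, by linarith, by linarith, ?_⟩
  intro z hz r hr1 hr2
  have hz1 := hz.1
  have hz2 := hz.2
  rcases le_total r (4 * s) with hr | hr
  · refine ⟨x', ⟨by linarith, by linarith⟩, p, ⟨by linarith, by linarith⟩, ?_, ?_, ?_⟩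
    · rw [abs_le]; constructor <;> linarith
    · rw [abs_le]; constructor <;> linarith
    · have : n * r ≤ n * (4 * s) := mul_le_mul_of_nonneg_left hr (by linarith)
      linarith
  · refine ⟨x, ⟨by linarith, by linarith⟩, x + r / 2, ⟨by linarith, by linarith⟩, ?_, ?_, ?_⟩
    · rw [abs_le]; constructor <;> linarith
    · rw [abs_le]; constructor <;> linarith
    · have := hsl (x + r / 2) ⟨by linarith, by linarith⟩
      have : 0 ≤ n * r := mul_nonneg (by linarith) (by linarith)
      linarith

lemma exists_infinite_slope {h : ℝ → ℝ} {α β : ℝ} (hc : ContinuousOn h (Icc α β))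
    (hcell : HasFlatCells h α β) {A B : ℝ} (hαA : α ≤ A) (hAB : A ≤ B) (hBβ : B ≤ β)
    (hrise : B - A < h B - h A) :
    ∃ z ∈ Icc α β, ∀ M : ℝ, ∀ᶠ r in 𝓝[>] (0 : ℝ),
      ∃ u ∈ Icc α β, ∃ v ∈ Icc α β, |u - z| ≤ r ∧ |v - z| ≤ r ∧ M * r ≤ h v - h u := by
  obtain ⟨x₀, h1, h2, h3, -⟩ := exists_steep_point (n := 1) zero_le_one hAB
    (hc.mono (Icc_subset_Icc hαA hBβ)) (by linarith)
  choose! X Y hXY using fun (n : ℕ) (q : ℝ × ℝ)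
      (hq : SteepFrom h α β (n + 1) q.1 q.2) =>
    hq.exists_next hc hcell (n' := (n + 1 : ℕ) + 1) (ε := 1 / ((n : ℝ) + 1))
      (by linarith [Nat.cast_nonneg (α := ℝ) n])
      (by push_cast; linarith [Nat.cast_nonneg (α := ℝ) n]) (by positivity)
  let q : ℕ → ℝ × ℝ := fun n => Nat.rec (x₀, B) (fun k q => (X k q, Y k q)) n
  have hq : ∀ n : ℕ, SteepFrom h α β (n + 1) (q n).1 (q n).2 := by
    intro n
    induction n with
    | zero => exact ⟨by simpa [q] using hαA.trans h1, h2, hBβ, by simpa [q] using h3⟩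
    | succ k ih => exact (hXY k (q k) ih).1
  have hstep := fun n => (hXY n (q n) (hq n)).2
  have hmono : Monotone fun n => (q n).1 := monotone_nat_of_le_succ fun n => (hstep n).1
  have hanti : Antitone fun n => (q n).2 := antitone_nat_of_succ_le fun n => (hstep n).2.1
  have hle : ∀ m n, (q m).1 ≤ (q n).2 := fun m n =>
    (hmono (le_max_left m n)).trans ((hq (max m n)).2.1.le.trans (hanti (le_max_right m n)))
  have hbdd : BddAbove (range fun n => (q n).1) := ⟨(q 0).2, by rintro _ ⟨n, rfl⟩; exact hle n 0⟩
  set z := ⨆ n, (q n).1 with hz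
  have hz1 : ∀ n, (q n).1 ≤ z := fun n => le_ciSup hbdd n
  have hz2 : ∀ n, z ≤ (q n).2 := fun n => ciSup_le fun m => hle m n
  have hlen : ∀ n : ℕ, (q (n + 1)).2 - (q (n + 1)).1 ≤ 1 / ((n : ℝ) + 1) := fun n => by
    have h1 : (q (n + 1)).2 ≤ (q n).1 + 1 / ((n : ℝ) + 1) := (hstep n).2.2.1
    have h2 : (q n).1 ≤ (q (n + 1)).1 := (hstep n).1
    linarith
  have hlen0 : Tendsto (fun n => (q (n + 1)).2 - (q (n + 1)).1) atTop (𝓝 0) :=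
    squeeze_zero (fun n => by linarith [(hq (n + 1)).2.1]) hlen
      tendsto_one_div_add_atTop_nhds_zero_nat
  refine ⟨z, ⟨(hq 0).1.trans (hz1 0), (hz2 0).trans (hq 0).2.2.1⟩, fun M => ?_⟩
  obtain ⟨k₀, hk₀⟩ := exists_nat_ge (32 * M)
  filter_upwards [Ioo_mem_nhdsGT (show 0 < (q k₀).2 - (q k₀).1 by linarith [(hq k₀).2.1])]
    with r hr
  classical
  have hex : ∃ m, (q (m + 1)).2 - (q (m + 1)).1 < r :=
    (hlen0.eventually (gt_mem_nhds hr.1)).exists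
  have hex' : ∃ m, k₀ ≤ m ∧ (q (m + 1)).2 - (q (m + 1)).1 ≤ r ∧ r ≤ (q m).2 - (q m).1 := by
    by_contra! hcon
    have key : ∀ m, k₀ ≤ m → r ≤ (q m).2 - (q m).1 := by
      intro m hm
      induction m, hm using Nat.le_induction with
      | base => exact hr.2.le
      | succ m hm ih =>
        by_contra! hlt
        linarith [hcon m hm hlt.le]
    obtain ⟨m, hm⟩ := ((hlen0.eventually (gt_mem_nhds hr.1)).and (eventually_ge_atTop k₀)).exists
    linarith [key (m + 1) (by omega), hm.1]
  obtain ⟨m, hm, hr1, hr2⟩ := hex'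
  obtain ⟨u, hu, v, hv, h4, h5, h6⟩ := (hstep m).2.2.2 z ⟨hz1 (m + 1), hz2 (m + 1)⟩ r hr1 hr2
  refine ⟨u, hu, v, hv, h4, h5, le_trans ?_ h6⟩
  have : (k₀ : ℝ) ≤ m := by exact_mod_cast hm
  have hr0 := hr.1
  gcongr
  linarith

/-- In every coordinate, `x` and `y` agree or lie in a common interval `[j s, j s + s - δ]`. -/
def SameCell {ι : Type*} (s δ : ℝ) (x y : ι → ℝ) : Prop :=
  ∀ i, x i = y i ∨ ∃ j : ℤ, x i ∈ Icc (j * s) (j * s + s - δ) ∧ y i ∈ Icc (j * s) (j * s + s - δ)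

/-- A continuous staircase within distance one of the identity, constant off short intervals. -/
lemma exists_continuous_staircase {N : ℕ} (hN : 0 < N) :
    ∃ τ : ℝ → ℝ, Continuous τ ∧ (∀ t, |τ t - t| ≤ 1) ∧
      ∀ j : ℤ, ∀ t ∈ Icc (j : ℝ) (j + 1 - 1 / N), τ t = j := by
  have hN1 : (1 : ℝ) ≤ N := by exact_mod_cast hN
  let c : ℝ → ℝ := fun u => max 0 (1 - N * (1 - u))
  refine ⟨fun t => t + ((fun u => c u - u) ∘ Int.fract) t, ?_, fun t => ?_, fun j t ht => ?_⟩
  · refine continuous_id.add (ContinuousOn.comp_fract'' (by fun_prop) ?_)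
    have : (1 : ℝ) - N ≤ 0 := by linarith
    simp [c, this]
  · have h0 := Int.fract_nonneg t
    have h1 := (Int.fract_lt_one t).le
    have h2 : 0 ≤ c (Int.fract t) := le_max_left _ _
    have h3 : c (Int.fract t) ≤ 1 := max_le zero_le_one (by nlinarith)
    simp only [Function.comp, add_sub_cancel_left, abs_le]
    constructor <;> linarith
  · have hpos : (0 : ℝ) < 1 / N := by positivity
    have hfl : ⌊t⌋ = j := Int.floor_eq_iff.2 ⟨ht.1, by linarith [ht.2]⟩
    have hfr : Int.fract t = t - j := by rw [Int.fract, hfl]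
    have h4 : 1 - (N : ℝ) * (1 - (t - j)) ≤ 0 := by
      have h5 : 1 / (N : ℝ) ≤ 1 - (t - j) := by linarith [ht.2]
      rw [div_le_iff₀ (by positivity)] at h5
      linarith
    simp only [Function.comp, hfr, c, max_eq_left h4]
    ring

lemma exists_continuous_cell_map {ι : Type*} [Fintype ι] {p N : ℕ} (hp : 0 < p) (hN : 0 < N) :
    ∃ T : (ι → ℝ) → (ι → ℝ), Continuous T ∧ (∀ x, dist x (T x) ≤ 1 / p) ∧
      ∀ x y, SameCell (1 / (p : ℝ)) (1 / ((p : ℝ) * N)) x y → T x = T y := by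
  obtain ⟨τ, hτ, hτ1, hτc⟩ := exists_continuous_staircase hN
  have hp' : (0 : ℝ) < p := by exact_mod_cast hp
  have hN' : (0 : ℝ) < N := by exact_mod_cast hN
  refine ⟨fun x i => τ (p * x i) / p, by fun_prop, fun x => ?_, fun x y hxy => ?_⟩
  · refine (dist_pi_le_iff (by positivity)).2 fun i => ?_
    have : x i - τ (p * x i) / p = -((τ (p * x i) - p * x i) / p) := by field_simp; ring
    rw [Real.dist_eq, this, abs_neg, abs_div, abs_of_pos hp']
    gcongr
    exact hτ1 _
  · funext i
    obtain hxy | ⟨j, hx, hy⟩ := hxy i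
    · simp only [hxy]
    have key : ∀ t ∈ Icc ((j : ℝ) * (1 / p)) (j * (1 / p) + 1 / p - 1 / (p * N)),
        τ (p * t) = j := by
      intro t ht
      refine hτc j _ ⟨?_, ?_⟩
      · have := mul_le_mul_of_nonneg_left ht.1 hp'.le
        field_simp at this ⊢
        linarith
      · have h2 := mul_le_mul_of_nonneg_left ht.2 hp'.le
        have : (p : ℝ) * (j * (1 / p) + 1 / p - 1 / (p * N)) = j + 1 - 1 / N := by field_simp
        linarith
    simp only [key _ hx, key _ hy]

/-- A set of continuous functions meeting every basic neighbourhood in an interior point is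
residual. -/
lemma mem_residual_of_approx {X : Type*} [TopologicalSpace X] {U : Set C(X, ℝ)}
    (h : ∀ (f : C(X, ℝ)) (K : Set X), IsCompact K → ∀ ε : ℝ, 0 < ε →
      ∃ g : C(X, ℝ), (∀ x ∈ K, dist (f x) (g x) < ε) ∧ ∃ L : Set X, IsCompact L ∧ ∃ η : ℝ, 0 < η ∧
        ∀ f' : C(X, ℝ), (∀ x ∈ L, dist (g x) (f' x) < η) → f' ∈ U) :
    U ∈ residual C(X, ℝ) := by
  have hnhds : ∀ (g : C(X, ℝ)) (L : Set X), IsCompact L → ∀ η : ℝ, 0 < η →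
      {f' : C(X, ℝ) | ∀ x ∈ L, dist (g x) (f' x) < η} ∈ 𝓝 g := fun g L hL η hη =>
    UniformSpace.mem_nhds_iff.2 ⟨_,
      ContinuousMap.hasBasis_compactConvergenceUniformity.mem_of_mem
        (i := (L, {p : ℝ × ℝ | dist p.1 p.2 < η})) ⟨hL, Metric.dist_mem_uniformity hη⟩,
      fun f' hf' => hf'⟩
  refine mem_of_superset (residual_of_dense_open (s := interior U) isOpen_interior ?_)
    interior_subset
  intro f
  rw [mem_closure_iff_nhds]
  intro W hW
  obtain ⟨V, hV, hVW⟩ := UniformSpace.mem_nhds_iff.1 hW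
  obtain ⟨⟨K, V'⟩, ⟨hK, hV'⟩, hsub⟩ :=
    ContinuousMap.hasBasis_compactConvergenceUniformity.mem_iff.1 hV
  obtain ⟨ε, hε, hεV⟩ := Metric.mem_uniformity_dist.1 hV'
  obtain ⟨g, hg, L, hL, η, hη, hU⟩ := h f K hK ε hε
  exact ⟨g, hVW (hsub fun x hx => hεV (hg x hx)),
    mem_interior_iff_mem_nhds.2 (mem_of_superset (hnhds g L hL η hη) hU)⟩

lemma residual_sameCell {d : ℕ} {Ω : Set (EuclideanSpace ℝ (Fin d))} {K : Set Ω}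
    (hK : IsCompact K) (p₀ : ℕ) (Nmin : ℕ → ℕ) (η : ℕ → ℕ → ℝ)
    (hη : ∀ p N, 0 < p → 0 < N → 0 < η p N) :
    {f : C(Ω, ℝ) | ∃ p N : ℕ, p₀ < p ∧ 0 < N ∧ Nmin p ≤ N ∧ ∀ x ∈ K, ∀ y ∈ K,
      SameCell (1 / (p : ℝ)) (1 / ((p : ℝ) * N)) x.1.ofLp y.1.ofLp → |f x - f y| < η p N}
      ∈ residual C(Ω, ℝ) := by
  refine mem_residual_of_approx fun f L hL ε hε => ?_
  have : CompactSpace L := isCompact_iff_compactSpace.1 hL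
  let e : L → (Fin d → ℝ) := fun x => x.1.1.ofLp
  have he : IsClosedEmbedding e := by
    refine Continuous.isClosedEmbedding (by fun_prop) fun x y hxy => ?_
    exact Subtype.ext (Subtype.ext ((WithLp.ofLp_injective 2) hxy))
  obtain ⟨F, hF⟩ := ContinuousMap.exists_extension he (f.restrict L)
  have hF' : ∀ x (hx : x ∈ L), F x.1.ofLp = f x := fun x hx =>
    DFunLike.congr_fun hF (⟨x, hx⟩ : L)
  have hunif := (isCompact_range he.continuous).uniformContinuousAt_of_continuousAt F
    (fun a _ => F.continuous.continuousAt) (Metric.dist_mem_uniformity hε)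
  obtain ⟨r, hr, hrF⟩ := Metric.mem_uniformity_dist.1 hunif
  obtain ⟨q, hq⟩ := exists_nat_one_div_lt hr
  set p := max q p₀ + 1 with hp
  have hpp : 0 < p := by omega
  set N := Nmin p + 1 with hN
  have hNN : 0 < N := by omega
  obtain ⟨T, hT, hTd, hTc⟩ := exists_continuous_cell_map (ι := Fin d) hpp hNN
  refine ⟨⟨fun x => F (T x.1.ofLp), by fun_prop⟩, fun x hx => ?_, K, hK, η p N / 2,
    half_pos (hη p N hpp hNN), fun f' hf' => ⟨p, N, by omega, hNN, by omega,
      fun x hx y hy hxy => ?_⟩⟩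
  · rw [← hF' x hx]
    refine hrF (a := x.1.ofLp) (b := T x.1.ofLp) ((hTd _).trans_lt ?_) ⟨⟨x, hx⟩, rfl⟩
    refine lt_of_le_of_lt ?_ hq
    apply one_div_le_one_div_of_le (by positivity)
    rw [hp]
    push_cast
    gcongr
    exact le_max_left _ _
  · have h1 := hf' x hx
    have h2 := hf' y hy
    simp only [ContinuousMap.coe_mk, hTc _ _ hxy] at h1 h2
    rw [← Real.dist_eq]
    have := dist_triangle_left (f' x) (f' y) (F (T y.1.ofLp))
    linarith

lemma residual_rising {m : ℕ} {Ω : Set (EuclideanSpace ℝ (Fin (m + 1)))} {Q : Set Ω}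
    (hQ : IsCompact Q) (a : ℝ) {ρ : ℝ} (hρ : 0 < ρ) :
    {f : C(Ω, ℝ) | ∃ b, a ≤ b ∧ b ≤ a + ρ ∧ ∀ x ∈ Q, ∀ y ∈ Q, x.1 0 = a → y.1 0 = b →
      (∀ i : Fin m, x.1 i.succ = y.1 i.succ) → b - a < f y - f x} ∈ residual C(Ω, ℝ) := by
  refine mem_residual_of_approx fun f K _ ε hε => ?_
  have hunif := hQ.uniformContinuousAt_of_continuousAt f
    (fun a _ => f.continuous.continuousAt) (Metric.dist_mem_uniformity (show 0 < ε / 4 by linarith))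
  obtain ⟨r, hr, hrf⟩ := Metric.mem_uniformity_dist.1 hunif
  obtain ⟨δ, hδ0, hδr, hδε, hδρ⟩ : ∃ δ : ℝ, 0 < δ ∧ δ < r ∧ δ ≤ ε / 8 ∧ δ ≤ ρ :=
    ⟨min (r / 2) (min (ε / 8) ρ), by positivity, (min_le_left _ _).trans_lt (by linarith),
      (min_le_right _ _).trans (min_le_left _ _), (min_le_right _ _).trans (min_le_right _ _)⟩
  refine ⟨⟨fun x => f x + ε / 2 * min 1 (max 0 ((x.1 0 - a) / δ)), by fun_prop⟩, fun x _ => ?_, Q,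
    hQ, ε / 32, by linarith, fun f' hf' => ⟨a + δ, by linarith, by linarith,
      fun x hx y hy hxa hyb hxy => ?_⟩⟩
  · have h1 : min (1 : ℝ) (max 0 ((x.1 0 - a) / δ)) ≤ 1 := min_le_left _ _
    have h0 : 0 ≤ min (1 : ℝ) (max 0 ((x.1 0 - a) / δ)) := le_min zero_le_one (le_max_left _ _)
    simp only [ContinuousMap.coe_mk, dist_self_add_right, Real.norm_eq_abs]
    rw [abs_of_nonneg (by positivity)]
    nlinarith
  · have hd : dist x y = δ := by
      rw [Subtype.dist_eq, EuclideanSpace.dist_eq, Fin.sum_univ_succ]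
      simp [hxy, hxa, hyb, Real.sqrt_sq_eq_abs, abs_of_pos hδ0]
    have h1 := hf' x hx
    have h2 := hf' y hy
    have h3 : dist (f x) (f y) < ε / 4 := hrf (hd.trans_lt hδr) hx
    simp only [ContinuousMap.coe_mk, hxa, hyb, sub_self, zero_div, add_sub_cancel_left,
      div_self hδ0.ne', max_self, Real.dist_eq, abs_lt] at h1 h2 h3
    norm_num at h1 h2
    linarith [h1.1, h1.2, h2.1, h2.2, h3.1, h3.2]

lemma coverNum_le_card {X ι : Type*} [PseudoMetricSpace X] [Fintype ι] {δ : ℝ} {E : Set X}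
    (F : ι → Set X) (hF : ∀ i, Metric.ediam (F i) ≤ ENNReal.ofReal δ) (hE : E ⊆ ⋃ i, F i) :
    coverNum δ E ≤ Fintype.card ι := by
  refine iInf₂_le (Fintype.card ι) ⟨F ∘ (Fintype.equivFin ι).symm, fun i => hF _, ?_⟩
  exact hE.trans ((Fintype.equivFin ι).symm.surjective.iUnion_comp F).ge

lemma coverNum_le_card_finset {X κ : Type*} [PseudoMetricSpace X] {δ : ℝ} {E : Set X} (T : Finset κ)
    (F : κ → Set X) (hF : ∀ i, Metric.ediam (F i) ≤ ENNReal.ofReal δ)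
    (hE : ∀ x ∈ E, ∃ i ∈ T, x ∈ F i) : coverNum δ E ≤ T.card := by
  refine (coverNum_le_card (ι := T) (fun i => F i) (fun i => hF i) fun x hx => ?_).trans
    (by rw [Fintype.card_coe])
  obtain ⟨i, hi, hxi⟩ := hE x hx
  exact mem_iUnion.2 ⟨⟨i, hi⟩, hxi⟩

lemma coverNum_mono {X : Type*} [PseudoMetricSpace X] {δ : ℝ} {E E' : Set X} (h : E ⊆ E') :
    coverNum δ E ≤ coverNum δ E' := by
  refine le_iInf₂ fun n ⟨F, hF, hE⟩ => iInf₂_le n ⟨F, hF, h.trans hE⟩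

lemma lpdim_mono {X : Type*} [PseudoMetricSpace X] {E E' : Set X} (h : E ⊆ E') :
    lpdim E ≤ lpdim E' :=
  le_iInf₂ fun G hG => iInf₂_le G (h.trans hG)

lemma one_le_coverNum {X : Type*} [PseudoMetricSpace X] {δ : ℝ} {E : Set X} (hE : E.Nonempty) :
    1 ≤ coverNum δ E := by
  refine le_iInf₂ fun n ⟨F, hF, hEF⟩ => ?_
  obtain ⟨x, hx⟩ := hE
  obtain ⟨i, -⟩ := mem_iUnion.1 (hEF hx)
  exact_mod_cast i.pos

lemma lbdim_nonneg {X : Type*} [PseudoMetricSpace X] {E : Set X} (hE : E.Nonempty) :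
    0 ≤ lbdim E := by
  refine le_liminf_of_le (by isBoundedDefault) (Eventually.of_forall fun r => ?_)
  refine mul_nonneg ?_ (by exact_mod_cast inv_nonneg.2 (abs_nonneg _))
  rw [← ENNReal.log_one]
  exact ENNReal.log_le_log (one_le_coverNum hE)

lemma lpdim_nonneg {X : Type*} [PseudoMetricSpace X] {E : Set X} (hE : E.Nonempty) :
    0 ≤ lpdim E := by
  refine le_iInf₂ fun G hG => ?_
  obtain ⟨x, hx⟩ := hE
  obtain ⟨n, hn⟩ := mem_iUnion.1 (hG hx)
  exact (lbdim_nonneg ⟨x, hn⟩).trans (le_iSup (fun n => lbdim (G n)) n)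

lemma exists_cover_of_log_lt {X : Type*} [PseudoMetricSpace X] {E : Set X} {r s : ℝ} (hr : 0 < r)
    (hr1 : r < 1) (h : ENNReal.log (coverNum r E) * ((|Real.log r|⁻¹ : ℝ) : EReal) < s) :
    ∃ (n : ℕ) (F : Fin n → Set X), (∀ i, Metric.ediam (F i) ≤ ENNReal.ofReal r) ∧
      E ⊆ (⋃ i, F i) ∧ (n : ℝ) * r ^ s ≤ 1 := by
  have hlog : Real.log r < 0 := Real.log_neg hr hr1
  have habs : |Real.log r| = - Real.log r := abs_of_neg hlog
  have hpos : 0 < |Real.log r|⁻¹ := by rw [habs]; exact inv_pos.2 (by linarith)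
  have htop : coverNum r E < ⊤ := by
    refine lt_of_le_of_ne le_top fun htop => ?_
    rw [htop, ENNReal.log_top, EReal.top_mul_coe_of_pos hpos] at h
    exact not_top_lt h
  obtain ⟨n, F, hF, hE, hn⟩ : ∃ (n : ℕ) (F : Fin n → Set X),
      (∀ i, Metric.ediam (F i) ≤ ENNReal.ofReal r) ∧ E ⊆ (⋃ i, F i) ∧ coverNum r E = n := by
    let P : ℕ → Prop := fun n => ∃ F : Fin n → Set X,
      (∀ i, Metric.ediam (F i) ≤ ENNReal.ofReal r) ∧ E ⊆ ⋃ i, F i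
    have hP : ∃ n, P n := by
      by_contra! hcon
      refine htop.ne ?_
      unfold coverNum
      simp only [iInf_eq_top]
      exact fun n hn => absurd hn (hcon n)
    classical
    obtain ⟨F, hF, hE⟩ := Nat.find_spec hP
    refine ⟨Nat.find hP, F, hF, hE, le_antisymm (iInf₂_le _ ⟨F, hF, hE⟩) ?_⟩
    exact le_iInf₂ fun n hn => by exact_mod_cast Nat.find_min' hP hn
  refine ⟨n, F, hF, hE, ?_⟩
  rcases Nat.eq_zero_or_pos n with rfl | hn0
  · simp
  have hn0' : (0 : ℝ) < n := by exact_mod_cast hn0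
  rw [hn, ENNReal.log_pos_real (by exact_mod_cast hn0.ne') (by simp), ENNReal.toReal_natCast,
    ← EReal.coe_mul, EReal.coe_lt_coe_iff, habs, ← div_eq_mul_inv, div_lt_iff₀ (by linarith)] at h
  rw [Real.rpow_def_of_pos hr, ← Real.exp_log hn0', ← Real.exp_add, Real.exp_le_one_iff]
  linarith

lemma dimH_le_of_lbdim_lt {X : Type*} [MetricSpace X] {E : Set X} {s : ℝ≥0}
    (h : lbdim E < (s : ℝ)) : dimH E ≤ s := by
  borelize X
  have hfreq := frequently_lt_of_liminf_lt (by isBoundedDefault) h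
  have hev : ∀ᶠ r : ℝ in 𝓝[>] 0, 0 < r ∧ r < 1 := Ioo_mem_nhdsGT one_pos
  obtain ⟨r, hr, hrs⟩ := exists_seq_forall_of_frequently (hfreq.and_eventually hev)
  choose n F hF hE hn using fun k => exists_cover_of_log_lt (hrs k).2.1 (hrs k).2.2 (hrs k).1
  refine dimH_le_of_hausdorffMeasure_ne_top (ne_top_of_le_ne_top ENNReal.one_ne_top ?_)
  have hr0 : Tendsto (fun k => ENNReal.ofReal (r k)) atTop (𝓝 0) := by
    simpa using ENNReal.tendsto_ofReal (hr.mono_right nhdsWithin_le_nhds)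
  refine (Measure.hausdorffMeasure_le_liminf_sum (s : ℝ) E _ hr0 F
    (Eventually.of_forall hF) (Eventually.of_forall hE)).trans ?_
  refine liminf_le_of_frequently_le' (Eventually.of_forall fun k => ?_).frequently
  calc ∑ i, Metric.ediam (F k i) ^ (s : ℝ)
      ≤ ∑ _i : Fin (n k), ENNReal.ofReal (r k) ^ (s : ℝ) := by
        gcongr with i
        exact hF k i
    _ = ENNReal.ofReal (n k * r k ^ (s : ℝ)) := by
        rw [Finset.sum_const, Finset.card_univ, Fintype.card_fin, nsmul_eq_mul,
          ENNReal.ofReal_mul (Nat.cast_nonneg _), ENNReal.ofReal_natCast,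
          ENNReal.ofReal_rpow_of_pos (hrs k).2.1]
    _ ≤ 1 := by
        rw [← ENNReal.ofReal_one]
        exact ENNReal.ofReal_le_ofReal (hn k)

lemma dimH_le_of_lpdim_lt {X : Type*} [MetricSpace X] {E : Set X} {s : ℝ≥0}
    (h : lpdim E < (s : ℝ)) : dimH E ≤ s := by
  obtain ⟨G, hG, hlt⟩ := by simpa only [lpdim, iInf_lt_iff] using h
  refine (dimH_mono hG).trans ?_
  rw [dimH_iUnion]
  exact iSup_le fun n => dimH_le_of_lbdim_lt ((le_iSup (fun n => lbdim (G n)) n).trans_lt hlt)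

lemma dimH_le_of_lpdim_le {X : Type*} [MetricSpace X] {E : Set X} {m : ℕ}
    (h : lpdim E ≤ m) : dimH E ≤ m := by
  refine ENNReal.le_of_forall_pos_le_add fun ε hε _ => ?_
  have := dimH_le_of_lpdim_lt (E := E) (s := m + ε) (h.trans_lt ?_)
  · simpa using this
  · have : (m : ℝ) < ((m + ε : ℝ≥0) : ℝ) := by push_cast; simpa using hε
    exact_mod_cast this

lemma le_lpdim_of_le_dimH {X : Type*} [MetricSpace X] {E : Set X} {m : ℕ} (hE : E.Nonempty)
    (h : (m : ℝ≥0∞) ≤ dimH E) : (m : EReal) ≤ lpdim E := by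
  by_contra! hlt
  obtain ⟨s, hs1, hs2⟩ := EReal.lt_iff_exists_real_btwn.1 hlt
  have hs0 : 0 ≤ s := by
    have := (lpdim_nonneg hE).trans hs1.le
    exact_mod_cast this
  lift s to ℝ≥0 using hs0
  have h1 := h.trans (dimH_le_of_lpdim_lt hs1)
  have h2 : (m : ℝ≥0) ≤ s := by exact_mod_cast h1
  have h3 : (s : ℝ) < m := by exact_mod_cast hs2
  exact absurd (show (m : ℝ) ≤ s by exact_mod_cast h2) (not_le.2 h3)

/-- The points of `[-R, R]^d` having some coordinate near the grid `(1 / p) ℤ`. -/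
def nearGrid {d : ℕ} (R p N : ℕ) : Set (EuclideanSpace ℝ (Fin d)) :=
  {x | (∀ i, |x i| ≤ R) ∧ ∃ i, ∀ j : ℤ,
    x i ∉ Icc (j * (1 / (p : ℝ)) + 1 / (p * N)) (j * (1 / (p : ℝ)) + 1 / p - 2 * (1 / (p * N)))}

lemma ediam_box_le {m : ℕ} {δ : ℝ} (hδ : 0 ≤ δ) (a : Fin (m + 1) → ℤ) :
    Metric.ediam {x : EuclideanSpace ℝ (Fin (m + 1)) | ∀ i, x i ∈ Icc (a i * δ) ((a i + 1) * δ)} ≤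
      ENNReal.ofReal ((m + 1) * δ) := by
  refine Metric.ediam_le fun x hx y hy => ?_
  rw [edist_dist]
  refine ENNReal.ofReal_le_ofReal ?_
  rw [EuclideanSpace.dist_eq]
  refine Real.sqrt_le_iff.2 ⟨by positivity, ?_⟩
  have hm : (0 : ℝ) ≤ m := Nat.cast_nonneg m
  calc ∑ i, dist (x i) (y i) ^ 2 ≤ ∑ _i : Fin (m + 1), δ ^ 2 := by
        gcongr with i
        have h1 := hx i
        have h2 := hy i
        rw [Real.dist_eq, abs_le]
        constructor <;> linarith [h1.1, h1.2, h2.1, h2.2]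
    _ = (m + 1) * δ ^ 2 := by simp
    _ ≤ ((m + 1) * δ) ^ 2 := by
        have : 0 ≤ δ ^ 2 * ((m : ℝ) * (m + 1)) := by positivity
        nlinarith

/-- The constant in the covering estimate for `nearGrid`. -/
def gridConst (m R p : ℕ) : ℕ := (m + 1) * (3 * (2 * R * p + 2)) * (2 * R * p + 1) ^ m

lemma floor_near_grid {p N : ℕ} (hp : 0 < p) (hN : 0 < N) {R : ℕ} {t : ℝ} (ht : |t| ≤ R)
    (hbad : ∀ j : ℤ,
      t ∉ Icc (j * (1 / (p : ℝ)) + 1 / (p * N)) (j * (1 / (p : ℝ)) + 1 / p - 2 * (1 / (p * N)))) :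
    ∃ j ∈ Finset.Icc (-(R * p : ℤ)) (R * p + 1), ∃ e ∈ Finset.Icc (-2 : ℤ) 0,
      j * N + e = ⌊t * (p * N)⌋ := by
  have hp' : (0 : ℝ) < p := by exact_mod_cast hp
  have hN' : (0 : ℝ) < N := by exact_mod_cast hN
  obtain ⟨ht1, ht2⟩ := abs_le.1 ht
  set j := ⌊t * p⌋ with hj
  have hj1 : (j : ℝ) ≤ t * p := Int.floor_le _
  have hj2 : t * p < j + 1 := Int.lt_floor_add_one _
  have hjR1 : -(R * p : ℤ) ≤ j := by
    rw [hj, Int.le_floor]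
    push_cast
    nlinarith
  have hjR2 : j ≤ R * p := by
    have : (j : ℝ) ≤ R * p := hj1.trans (by nlinarith)
    exact_mod_cast this
  have hlow : (j : ℝ) * N ≤ t * (p * N) := by nlinarith
  have hupp : t * (p * N) < (j + 1) * N := by nlinarith
  have hmul : ∀ u v : ℝ, u ≤ v ↔ u * (p * N) ≤ v * (p * N) := fun u v =>
    (mul_le_mul_iff_of_pos_right (by positivity)).symm
  have hcases := hbad j
  rw [mem_Icc, hmul _ t, hmul t] at hcases
  rw [show ((j : ℝ) * (1 / p) + 1 / (p * N)) * (p * N) = j * N + 1 by field_simp,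
    show ((j : ℝ) * (1 / p) + 1 / p - 2 * (1 / (p * N))) * (p * N) = j * N + N - 2 by
      field_simp] at hcases
  rcases not_and_or.1 hcases with h | h
  · refine ⟨j, Finset.mem_Icc.2 ⟨hjR1, by linarith⟩, 0, by simp, ?_⟩
    symm
    rw [Int.floor_eq_iff]
    push_cast
    constructor <;> linarith
  · refine ⟨j + 1, Finset.mem_Icc.2 ⟨by linarith, by linarith⟩, ⌊t * (p * N)⌋ - (j + 1) * N,
      Finset.mem_Icc.2 ⟨?_, ?_⟩, by ring⟩
    · have : (j + 1) * N - 2 ≤ ⌊t * (p * N)⌋ := by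
        rw [Int.le_floor]
        push_cast
        linarith
      linarith
    · have : ⌊t * (p * N)⌋ < (j + 1) * N := by
        rw [Int.floor_lt]
        push_cast
        linarith
      linarith

/-- The integer vectors indexing the cubes of side `1 / (p N)` that meet `nearGrid R p N`. -/
noncomputable def gridIndex (m R p N : ℕ) : Finset (Fin (m + 1) → ℤ) :=
  Finset.univ.biUnion fun i => Fintype.piFinset fun l => if l = i then
    (Finset.Icc (-(R * p : ℤ)) (R * p + 1) ×ˢ Finset.Icc (-2 : ℤ) 0).image
      fun q : ℤ × ℤ => q.1 * N + q.2
  else Finset.Icc (-(R * p * N : ℤ)) (R * p * N)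

lemma card_gridIndex_le {m R p N : ℕ} (hN : 0 < N) :
    (gridIndex m R p N).card ≤ gridConst m R p * N ^ m := by
  have hS : ((Finset.Icc (-(R * p : ℤ)) (R * p + 1) ×ˢ Finset.Icc (-2 : ℤ) 0).image
      fun q : ℤ × ℤ => q.1 * N + q.2).card ≤ 3 * (2 * R * p + 2) := by
    refine Finset.card_image_le.trans ?_
    rw [Finset.card_product, Int.card_Icc, Int.card_Icc]
    have : ((R : ℤ) * p + 1 + 1 - -(R * p)).toNat = 2 * R * p + 2 := by
      rw [show ((R : ℤ) * p + 1 + 1 - -(R * p)) = ((2 * R * p + 2 : ℕ) : ℤ) by push_cast; ring]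
      exact Int.toNat_natCast _
    rw [this, mul_comm]
    rfl
  have hI : (Finset.Icc (-(R * p * N : ℤ)) (R * p * N)).card ≤ (2 * R * p + 1) * N := by
    rw [Int.card_Icc, show ((R : ℤ) * p * N + 1 - -(R * p * N)) =
      ((2 * R * p * N + 1 : ℕ) : ℤ) by push_cast; ring, Int.toNat_natCast, add_mul, one_mul]
    exact Nat.add_le_add_left hN _
  refine Finset.card_biUnion_le.trans ?_
  calc _ ≤ ∑ _i : Fin (m + 1), (3 * (2 * R * p + 2)) * ((2 * R * p + 1) * N) ^ m := by
        refine Finset.sum_le_sum fun i _ => ?_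
        rw [Fintype.card_piFinset, Fin.prod_univ_succAbove _ i]
        simp only [if_true, Fin.succAbove_ne, if_false, Finset.prod_const, Finset.card_univ,
          Fintype.card_fin]
        exact Nat.mul_le_mul hS (Nat.pow_le_pow_left hI m)
    _ = gridConst m R p * N ^ m := by
        rw [Finset.sum_const, Finset.card_univ, Fintype.card_fin, smul_eq_mul, gridConst, mul_pow]
        ring

lemma floor_mem_gridIndex {m R p N : ℕ} (hp : 0 < p) (hN : 0 < N)
    {x : EuclideanSpace ℝ (Fin (m + 1))} (hx : x ∈ nearGrid R p N) :
    (fun l => ⌊x l * (p * N)⌋) ∈ gridIndex m R p N := by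
  have hp' : (0 : ℝ) < p := by exact_mod_cast hp
  have hN' : (0 : ℝ) < N := by exact_mod_cast hN
  obtain ⟨hxR, i, hi⟩ := hx
  refine Finset.mem_biUnion.2 ⟨i, Finset.mem_univ _, Fintype.mem_piFinset.2 fun l => ?_⟩
  split_ifs with hl
  · subst hl
    obtain ⟨j, hj, e, he, hje⟩ := floor_near_grid hp hN (hxR l) hi
    exact Finset.mem_image.2 ⟨(j, e), Finset.mem_product.2 ⟨hj, he⟩, hje⟩
  · obtain ⟨h1, h2⟩ := abs_le.1 (hxR l)
    have hpos : (0 : ℝ) < p * N := by positivity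
    refine Finset.mem_Icc.2 ⟨?_, ?_⟩
    · rw [Int.le_floor]
      push_cast
      nlinarith
    · have h3 : (⌊x l * (p * N)⌋ : ℝ) ≤ R * p * N := (Int.floor_le _).trans (by nlinarith)
      exact_mod_cast h3

lemma coverNum_nearGrid_le {m R p N : ℕ} (hp : 0 < p) (hN : 0 < N) :
    coverNum ((m + 1) * (1 / ((p : ℝ) * N)))
      (nearGrid R p N : Set (EuclideanSpace ℝ (Fin (m + 1)))) ≤
      ((gridConst m R p * N ^ m : ℕ) : ℝ≥0∞) := by
  have hp' : (0 : ℝ) < p := by exact_mod_cast hp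
  have hN' : (0 : ℝ) < N := by exact_mod_cast hN
  have hpos : (0 : ℝ) < p * N := by positivity
  refine (coverNum_le_card_finset (gridIndex m R p N)
    (fun a => {x : EuclideanSpace ℝ (Fin (m + 1)) |
      ∀ i, x i ∈ Icc ((a i : ℝ) * (1 / (p * N))) ((a i + 1) * (1 / (p * N)))})
    (fun a => ediam_box_le (by positivity) a) fun x hx => ?_).trans
      (Nat.cast_le.2 (card_gridIndex_le hN))
  refine ⟨_, floor_mem_gridIndex hp hN hx, fun l => ⟨?_, ?_⟩⟩
  · rw [mul_one_div, div_le_iff₀ hpos]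
    exact Int.floor_le (x l * (p * N))
  · rw [mul_one_div, le_div_iff₀ hpos]
    exact (Int.lt_floor_add_one (x l * (p * N))).le

lemma log_coverNum_mul_le {X : Type*} [PseudoMetricSpace X] {E : Set X} {r t : ℝ} {n : ℕ}
    (hr : 0 < r) (hr1 : r < 1) (hn : 0 < n) (hE : coverNum r E ≤ n)
    (h : Real.log n ≤ t * |Real.log r|) :
    ENNReal.log (coverNum r E) * ((|Real.log r|⁻¹ : ℝ) : EReal) ≤ (t : EReal) := by
  have hpos : 0 < |Real.log r| := abs_pos.2 (Real.log_neg hr hr1).ne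
  calc ENNReal.log (coverNum r E) * ((|Real.log r|⁻¹ : ℝ) : EReal)
      ≤ ENNReal.log n * ((|Real.log r|⁻¹ : ℝ) : EReal) :=
        mul_le_mul_of_nonneg_right (ENNReal.log_le_log hE)
          (by exact_mod_cast (inv_pos.2 hpos).le)
    _ ≤ (t : EReal) := by
        rw [ENNReal.log_pos_real (by exact_mod_cast hn.ne') (by simp), ENNReal.toReal_natCast,
          ← EReal.coe_mul, EReal.coe_le_coe_iff, ← div_eq_mul_inv, div_le_iff₀ hpos]
        exact h

lemma lbdim_le_of_subset_nearGrid {m : ℕ} {E : Set (EuclideanSpace ℝ (Fin (m + 1)))} {p N : ℕ → ℕ}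
    (hp : ∀ k, k + m < p k) (hN : ∀ k, gridConst m (k + 1) (p k) ^ (k + 1) + 2 ≤ N k)
    (hE : ∀ᶠ k in atTop, E ⊆ nearGrid (k + 1) (p k) (N k)) : lbdim E ≤ m := by
  have hp0 : ∀ k, (0 : ℝ) < p k := fun k => by exact_mod_cast (by have := hp k; omega : 0 < p k)
  have hN2 : ∀ k, (2 : ℝ) ≤ N k := fun k => by exact_mod_cast (by have := hN k; omega : 2 ≤ N k)
  have hm0 : (0 : ℝ) ≤ m := Nat.cast_nonneg m
  let r : ℕ → ℝ := fun k => (m + 1) * (1 / ((p k : ℝ) * N k))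
  have hr0 : ∀ k, 0 < r k := fun k => by
    have := hp0 k
    have := hN2 k
    positivity
  have hrN : ∀ k, r k ≤ (N k : ℝ)⁻¹ := fun k => by
    have h1 := hp0 k
    have h2 : (0 : ℝ) < N k := by linarith [hN2 k]
    have h3 : (m : ℝ) + 1 ≤ p k := by exact_mod_cast (by have := hp k; omega : m + 1 ≤ p k)
    calc r k ≤ p k * (1 / ((p k : ℝ) * N k)) := by
          simp only [r]
          gcongr
      _ = (N k : ℝ)⁻¹ := by field_simp
  have hr1 : ∀ k, r k < 1 := fun k => (hrN k).trans_lt (inv_lt_one_of_one_lt₀ (by linarith [hN2 k]))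
  have hlog : ∀ k, Real.log (N k) ≤ |Real.log (r k)| := fun k => by
    rw [abs_of_neg (Real.log_neg (hr0 k) (hr1 k)), le_neg, ← Real.log_inv]
    exact Real.log_le_log (hr0 k) (hrN k)
  have hrlim : Tendsto r atTop (𝓝[>] 0) := by
    refine tendsto_nhdsWithin_iff.2 ⟨?_, Eventually.of_forall hr0⟩
    have hlim : Tendsto (fun k : ℕ => ((m : ℝ) + 1) * (1 / ((k : ℝ) + 1))) atTop (𝓝 0) := by
      simpa using (tendsto_one_div_add_atTop_nhds_zero_nat (𝕜 := ℝ)).const_mul ((m : ℝ) + 1)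
    refine squeeze_zero (fun k => (hr0 k).le) (fun k => ?_) hlim
    have h3 : (k : ℝ) + 1 ≤ p k := by exact_mod_cast (by have := hp k; omega : k + 1 ≤ p k)
    simp only [r]
    gcongr
    nlinarith [hN2 k]
  have hval : ∀ᶠ k in atTop, ENNReal.log (coverNum (r k) E) * ((|Real.log (r k)|⁻¹ : ℝ) : EReal) ≤
      ((m + 1 / ((k : ℝ) + 1) : ℝ) : EReal) := by
    filter_upwards [hE] with k hk
    have hc : 0 < gridConst m (k + 1) (p k) := by
      unfold gridConst
      positivity
    have hNk : 0 < N k := by have := hN k; omega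
    refine log_coverNum_mul_le (n := gridConst m (k + 1) (p k) * N k ^ m) (hr0 k) (hr1 k)
      (by positivity) ((coverNum_mono hk).trans
        (coverNum_nearGrid_le (by have := hp k; omega) hNk)) ?_
    have h1 : ((k : ℝ) + 1) * Real.log (gridConst m (k + 1) (p k)) ≤ Real.log (N k) := by
      rw [← Nat.cast_add_one, ← Real.log_pow]
      refine Real.log_le_log (by positivity) ?_
      exact_mod_cast (by have := hN k; omega : gridConst m (k + 1) (p k) ^ (k + 1) ≤ N k)
    have h2 : Real.log (gridConst m (k + 1) (p k)) ≤ 1 / ((k : ℝ) + 1) * Real.log (N k) := by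
      rw [one_div_mul_eq_div, le_div_iff₀ (by positivity)]
      linarith
    have h3 : (0 : ℝ) ≤ m + 1 / ((k : ℝ) + 1) := by positivity
    push_cast
    rw [Real.log_mul (by positivity) (by positivity), Real.log_pow]
    calc _ ≤ (m + 1 / ((k : ℝ) + 1)) * Real.log (N k) := by linarith
      _ ≤ _ := mul_le_mul_of_nonneg_left (hlog k) h3
  refine EReal.le_of_forall_lt_iff_le.1 fun s hs => ?_
  have hs' : (m : ℝ) < s := by exact_mod_cast hs
  refine liminf_le_of_frequently_le' (hrlim.frequently (Eventually.frequently ?_))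
  have hlim : Tendsto (fun k : ℕ => (m : ℝ) + 1 / ((k : ℝ) + 1)) atTop (𝓝 m) := by
    simpa using (tendsto_one_div_add_atTop_nhds_zero_nat (𝕜 := ℝ)).const_add (m : ℝ)
  filter_upwards [hval, hlim.eventually (gt_mem_nhds hs')] with k h1 h2
  exact h1.trans (EReal.coe_le_coe_iff.2 h2.le)

lemma mem_nearGrid_of_le_diam {m : ℕ} {Ω : Set (EuclideanSpace ℝ (Fin (m + 1)))}
    {f : Ω → ℝ} {K : Set Ω} {R p N : ℕ} {η : ℝ}
    (hf : ∀ x ∈ K, ∀ y ∈ K,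
      SameCell (1 / (p : ℝ)) (1 / ((p : ℝ) * N)) x.1.ofLp y.1.ofLp → |f x - f y| < η)
    {x : Ω} (hxR : ‖x.1‖ ≤ R) (hxK : Metric.closedBall x (1 / ((p : ℝ) * N)) ⊆ K)
    (hdiam : ENNReal.ofReal (2 * η) < Metric.ediam (f '' Metric.closedBall x (1 / ((p : ℝ) * N)))) :
    x.1 ∈ nearGrid R p N := by
  refine ⟨fun i => (PiLp.norm_apply_le x.1 i).trans hxR, ?_⟩
  by_contra! hdeep
  choose j hj using hdeep
  set δ : ℝ := 1 / ((p : ℝ) * N) with hδ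
  have hδ0 : 0 ≤ δ := by positivity
  have hclose : ∀ y ∈ Metric.closedBall x δ, |f x - f y| < η := by
    intro y hy
    refine hf x (hxK (Metric.mem_closedBall_self hδ0)) y (hxK hy) fun i => Or.inr ⟨j i, ?_, ?_⟩
    · exact ⟨by linarith [(hj i).1], by linarith [(hj i).2]⟩
    · have h1 : |y.1 i - x.1 i| ≤ δ := by
        have h2 := PiLp.norm_apply_le (y.1 - x.1) i
        rw [← dist_eq_norm] at h2
        exact h2.trans hy
      rw [abs_le] at h1
      exact ⟨by linarith [(hj i).1, h1.1], by linarith [(hj i).2, h1.2]⟩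
  refine hdiam.not_ge (Metric.ediam_le ?_)
  rintro _ ⟨y, hy, rfl⟩ _ ⟨z, hz, rfl⟩
  rw [edist_dist]
  refine ENNReal.ofReal_le_ofReal ?_
  have h1 := hclose y hy
  have h2 := hclose z hz
  rw [Real.dist_eq]
  rw [abs_lt] at h1 h2
  rw [abs_le]
  constructor <;> linarith [h1.1, h1.2, h2.1, h2.2]

lemma lpdim_lipGauge_pos_le {m : ℕ} {Ω : Set (EuclideanSpace ℝ (Fin (m + 1)))}
    (K : CompactExhaustion Ω) {φ : ℝ → ℝ} (hφ : ∀ r, 0 < r → 0 < φ r) {f : Ω → ℝ} {p N : ℕ → ℕ}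
    (hp : ∀ k, k + m < p k) (hN : ∀ k, gridConst m (k + 1) (p k) ^ (k + 1) + 2 ≤ N k)
    (hf : ∀ k, ∀ x ∈ K k, ∀ y ∈ K k,
      SameCell (1 / (p k : ℝ)) (1 / ((p k : ℝ) * N k)) x.1.ofLp y.1.ofLp →
        |f x - f y| < φ (1 / ((p k : ℝ) * N k)) / (k + 1)) :
    lpdim {x : EuclideanSpace ℝ (Fin (m + 1)) | ∃ hx : x ∈ Ω, 0 < lipGauge φ f ⟨x, hx⟩} ≤ m := by
  let G : ℕ → Set (EuclideanSpace ℝ (Fin (m + 1))) := fun n =>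
    ⋂ k ≥ n, nearGrid (k + 1) (p k) (N k)
  refine (iInf₂_le G ?_).trans (iSup_le fun n => lbdim_le_of_subset_nearGrid hp hN ?_)
  swap
  · filter_upwards [eventually_ge_atTop n] with k hk
    exact iInter₂_subset k hk
  rintro x ⟨hx, hlip⟩
  obtain ⟨c, hc0, hc⟩ := ENNReal.lt_iff_exists_nnreal_btwn.1 hlip
  have hc0' : (0 : ℝ) < c := by exact_mod_cast hc0
  have hev := eventually_lt_of_lt_liminf hc
  set δ : ℕ → ℝ := fun k => 1 / ((p k : ℝ) * N k) with hδ
  have hp1 : ∀ k : ℕ, (k : ℝ) + 1 ≤ p k := fun k => by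
    exact_mod_cast (by have := hp k; omega : k + 1 ≤ p k)
  have hN1 : ∀ k, (1 : ℝ) ≤ N k := fun k => by exact_mod_cast (by have := hN k; omega : 1 ≤ N k)
  have hδ0 : ∀ k, 0 < δ k := fun k => by
    have hN0 : (0 : ℝ) < N k := by linarith [hN1 k]
    have hp0 : (0 : ℝ) < p k := by linarith [hp1 k, k.cast_nonneg (α := ℝ)]
    positivity
  have hδlim : Tendsto δ atTop (𝓝[>] 0) := by
    refine tendsto_nhdsWithin_iff.2 ⟨?_, Eventually.of_forall hδ0⟩
    refine squeeze_zero (fun k => (hδ0 k).le) (fun k => ?_) tendsto_one_div_add_atTop_nhds_zero_nat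
    simp only [hδ]
    gcongr
    nlinarith [hN1 k, hp1 k]
  obtain ⟨n₀, hn₀⟩ : ∃ n, (⟨x, hx⟩ : Ω) ∈ K n := by
    have := K.iUnion_eq ▸ mem_univ (⟨x, hx⟩ : Ω)
    exact mem_iUnion.1 this
  obtain ⟨ρ, hρ, hball⟩ := Metric.isOpen_iff.1 isOpen_interior _ (K.subset_interior_succ n₀ hn₀)
  have hδρ : ∀ᶠ k in atTop, δ k < ρ :=
    (hδlim.mono_right nhdsWithin_le_nhds).eventually (gt_mem_nhds hρ)
  have hkc : ∀ᶠ k : ℕ in atTop, 2 * (1 / ((k : ℝ) + 1)) < c := by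
    have hlim : Tendsto (fun k : ℕ => 2 * (1 / ((k : ℝ) + 1))) atTop (𝓝 0) := by
      simpa using (tendsto_one_div_add_atTop_nhds_zero_nat (𝕜 := ℝ)).const_mul (2 : ℝ)
    exact hlim.eventually (gt_mem_nhds hc0')
  have hkx : ∀ᶠ k : ℕ in atTop, ‖x‖ ≤ k := tendsto_natCast_atTop_atTop.eventually_ge_atTop _
  have hmem : ∀ᶠ k in atTop, x ∈ nearGrid (k + 1) (p k) (N k) := by
    filter_upwards [hδlim.eventually hev, hδρ, hkc, hkx, eventually_ge_atTop (n₀ + 1)]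
      with k h1 h2 h3 h4 h5
    refine mem_nearGrid_of_le_diam (x := ⟨x, hx⟩) (hf k) (by push_cast; linarith) ?_ ?_
    · exact (Metric.closedBall_subset_ball h2).trans
        (hball.trans (interior_subset.trans (K.subset h5)))
    · have hφk := hφ _ (hδ0 k)
      refine lt_of_le_of_lt ?_ (ENNReal.mul_lt_of_lt_div h1)
      rw [← ENNReal.ofReal_coe_nnreal, ← ENNReal.ofReal_mul c.coe_nonneg]
      refine ENNReal.ofReal_le_ofReal ?_
      calc 2 * (φ (δ k) / (k + 1)) = 2 * (1 / ((k : ℝ) + 1)) * φ (δ k) := by ring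
        _ ≤ c * φ (δ k) := by gcongr
  obtain ⟨n, hn⟩ := eventually_atTop.1 hmem
  exact mem_iUnion.2 ⟨n, mem_iInter₂.2 hn⟩

lemma lipGauge_eq_top {X : Type*} [PseudoMetricSpace X] {φ : ℝ → ℝ} (hφ : ∀ r, 0 < r → 0 < φ r)
    (hφ1 : ∃ C : ℝ, ∀ᶠ r in 𝓝[>] (0 : ℝ), φ r / r ≤ C) {f : X → ℝ} {x : X}
    (h : ∀ M : ℝ, ∀ᶠ r in 𝓝[>] (0 : ℝ), ∃ u ∈ Metric.closedBall x r, ∃ v ∈ Metric.closedBall x r,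
      M * r ≤ f v - f u) :
    lipGauge φ f x = ⊤ := by
  obtain ⟨C, hC⟩ := hφ1
  refine ENNReal.eq_top_of_forall_nnreal_le fun M => le_liminf_of_le (by isBoundedDefault) ?_
  filter_upwards [hC, h (M * C), self_mem_nhdsWithin] with r h1 h2 (hr : 0 < r)
  obtain ⟨u, hu, v, hv, huv⟩ := h2
  rw [ENNReal.le_div_iff_mul_le (by simp [hφ r hr]) (by simp)]
  refine le_trans ?_ (Metric.edist_le_ediam_of_mem (mem_image_of_mem f hv) (mem_image_of_mem f hu))
  rw [edist_dist, ← ENNReal.ofReal_coe_nnreal, ← ENNReal.ofReal_mul M.coe_nonneg]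
  refine ENNReal.ofReal_le_ofReal ?_
  rw [div_le_iff₀ hr] at h1
  calc (M : ℝ) * φ r ≤ M * (C * r) := mul_le_mul_of_nonneg_left h1 M.coe_nonneg
    _ = M * C * r := by ring
    _ ≤ f v - f u := huv
    _ ≤ dist (f v) (f u) := le_abs_self _

/-- The point of `ℝ^(m+1)` with first coordinate `t` and remaining coordinates `y`. -/
def linePoint {m : ℕ} (y : Fin m → ℝ) (t : ℝ) : EuclideanSpace ℝ (Fin (m + 1)) :=
  WithLp.toLp 2 (Fin.cons t y)

lemma continuous_uncurry_linePoint {m : ℕ} :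
    Continuous fun q : ℝ × (Fin m → ℝ) => linePoint q.2 q.1 := by
  refine (PiLp.continuous_toLp 2 _).comp (continuous_pi fun i => ?_)
  refine Fin.cases ?_ (fun i => ?_) i
  · exact continuous_fst
  · exact (continuous_apply i).comp continuous_snd

lemma dist_linePoint {m : ℕ} (y : Fin m → ℝ) (s t : ℝ) :
    dist (linePoint y s) (linePoint y t) = |s - t| := by
  rw [EuclideanSpace.dist_eq, Fin.sum_univ_succ]
  simp [linePoint, Real.sqrt_sq_eq_abs, Real.dist_eq]

lemma exists_lipGauge_eq_top_on_line {m : ℕ} {Ω : Set (EuclideanSpace ℝ (Fin (m + 1)))}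
    {φ : ℝ → ℝ} (hφ : ∀ r, 0 < r → 0 < φ r)
    (hφ1 : ∃ C : ℝ, ∀ᶠ r in 𝓝[>] (0 : ℝ), φ r / r ≤ C) {f : Ω → ℝ} (hfc : Continuous f)
    {y : Fin m → ℝ} {α β : ℝ} (hΩ : ∀ t ∈ Icc α β, linePoint y t ∈ Ω) {K : ℕ → Set Ω}
    (hK : ∀ᶠ k in atTop, ∀ t (ht : t ∈ Icc α β), (⟨linePoint y t, hΩ t ht⟩ : Ω) ∈ K k)
    {p N : ℕ → ℕ} (hp : ∀ k, k < p k) (hN : ∀ k, k < N k)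
    (hf : ∀ k, ∀ x ∈ K k, ∀ z ∈ K k,
      SameCell (1 / (p k : ℝ)) (1 / ((p k : ℝ) * N k)) x.1.ofLp z.1.ofLp →
        |f x - f z| < 1 / p k / (k + 1))
    {b : ℝ} (hαb : α ≤ b) (hbβ : b ≤ β)
    (hrise : b - α < f ⟨_, hΩ b ⟨hαb, hbβ⟩⟩ - f ⟨_, hΩ α ⟨le_rfl, hαb.trans hbβ⟩⟩) :
    ∃ t, ∃ ht : t ∈ Icc α β, lipGauge φ f ⟨linePoint y t, hΩ t ht⟩ = ⊤ := by
  have hαβ := hαb.trans hbβ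
  let F : Icc α β → ℝ := fun t => f ⟨linePoint y t, hΩ t t.2⟩
  have hF : Continuous F :=
    hfc.comp ((continuous_uncurry_linePoint.comp
      (continuous_subtype_val.prodMk continuous_const)).subtype_mk _)
  let h : ℝ → ℝ := IccExtend hαβ F
  have hh : ∀ t (ht : t ∈ Icc α β), h t = f ⟨linePoint y t, hΩ t ht⟩ := fun t ht =>
    IccExtend_of_mem hαβ F ht
  have hflat : HasFlatCells h α β := by
    intro ε hε
    have hlim := (tendsto_one_div_add_atTop_nhds_zero_nat (𝕜 := ℝ)).eventually (gt_mem_nhds hε)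
    obtain ⟨k, hk, hkε⟩ := (hK.and hlim).exists
    have hp1 : (k : ℝ) + 1 ≤ p k := by exact_mod_cast hp k
    have hN1 : (k : ℝ) + 1 ≤ N k := by exact_mod_cast hN k
    have hk0 : (0 : ℝ) < k + 1 := by positivity
    have hp0 : (0 : ℝ) < p k := by linarith
    have hN0 : (0 : ℝ) < N k := by linarith
    refine ⟨1 / p k, 1 / (p k * N k), by positivity, ?_, by positivity, ?_, ?_⟩
    · exact (one_div_le_one_div_of_le hk0 hp1).trans hkε.le
    · calc 1 / ((p k : ℝ) * N k) = 1 / N k * (1 / p k) := by field_simp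
        _ ≤ ε * (1 / p k) := by
          gcongr
          exact (one_div_le_one_div_of_le hk0 hN1).trans hkε.le
    · intro j s hs t ht hsj htj
      rw [hh s hs, hh t ht]
      refine (hf k _ (hk s hs) _ (hk t ht) fun i => ?_).le.trans ?_
      · refine Fin.cases (Or.inr ⟨j, ?_, ?_⟩) (fun i => Or.inl ?_) i
        · simpa [linePoint] using hsj
        · simpa [linePoint] using htj
        · simp [linePoint]
      · calc 1 / (p k : ℝ) / (k + 1) = 1 / ((k : ℝ) + 1) * (1 / p k) := by field_simp
          _ ≤ ε * (1 / p k) := by gcongr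
  have hr : b - α < h b - h α := by
    rw [hh b ⟨hαb, hbβ⟩, hh α ⟨le_rfl, hαβ⟩]
    exact hrise
  obtain ⟨z, hz, hzM⟩ := exists_infinite_slope (h := h) hF.Icc_extend'.continuousOn hflat le_rfl hαb
    hbβ hr
  refine ⟨z, hz, lipGauge_eq_top hφ hφ1 fun M => ?_⟩
  filter_upwards [hzM M] with r ⟨u, hu, v, hv, h1, h2, h3⟩
  refine ⟨⟨linePoint y u, hΩ u hu⟩, ?_, ⟨linePoint y v, hΩ v hv⟩, ?_, ?_⟩
  · rw [Metric.mem_closedBall, Subtype.dist_eq, dist_linePoint]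
    exact h1
  · rw [Metric.mem_closedBall, Subtype.dist_eq, dist_linePoint]
    exact h2
  · rwa [← hh u hu, ← hh v hv]

lemma le_dimH_of_forall_line {m : ℕ} {E : Set (EuclideanSpace ℝ (Fin (m + 1)))}
    {B : Set (Fin m → ℝ)} (hB : (interior B).Nonempty) (h : ∀ y ∈ B, ∃ t, linePoint y t ∈ E) :
    (m : ℝ≥0∞) ≤ dimH E := by
  let P : EuclideanSpace ℝ (Fin (m + 1)) → (Fin m → ℝ) := fun x i => x i.succ
  have hP : LipschitzWith 1 P := LipschitzWith.of_dist_le_mul fun x z => by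
    rw [NNReal.coe_one, one_mul]
    refine (dist_pi_le_iff dist_nonneg).2 fun i => ?_
    have h2 := PiLp.norm_apply_le (x - z) i.succ
    rw [← dist_eq_norm] at h2
    exact h2
  have hsub : B ⊆ P '' E := fun y hy => by
    obtain ⟨t, ht⟩ := h y hy
    exact ⟨_, ht, by funext i; simp [P, linePoint]⟩
  calc (m : ℝ≥0∞) = dimH B := by
        rw [Real.dimH_of_nonempty_interior hB, Module.finrank_fin_fun]
    _ ≤ dimH (P '' E) := dimH_mono hsub
    _ ≤ dimH E := hP.dimH_image_le E

lemma exists_closed_box_subset {m : ℕ} {Ω : Set (EuclideanSpace ℝ (Fin (m + 1)))}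
    (hint : (interior Ω).Nonempty) :
    ∃ (α ρ : ℝ) (c : Fin m → ℝ), 0 < ρ ∧ ∀ t ∈ Icc α (α + ρ),
      ∀ y ∈ Metric.closedBall c ρ, linePoint y t ∈ Ω := by
  obtain ⟨x, hx⟩ := hint
  let L : ℝ × (Fin m → ℝ) → EuclideanSpace ℝ (Fin (m + 1)) := fun q => linePoint q.2 q.1
  have hL : Continuous L := continuous_uncurry_linePoint
  have hxL : L (x 0, fun i => x i.succ) = x := by
    ext i
    refine Fin.cases ?_ (fun i => ?_) i <;> simp [L, linePoint]
  have hnhds : L ⁻¹' interior Ω ∈ 𝓝 (x 0, fun i : Fin m => x i.succ) :=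
    hL.continuousAt.preimage_mem_nhds (by rw [hxL]; exact isOpen_interior.mem_nhds hx)
  obtain ⟨ρ, hρ, hsub⟩ := Metric.nhds_basis_closedBall.mem_iff.1 hnhds
  refine ⟨x 0, ρ, fun i => x i.succ, hρ, fun t ht y hy => ?_⟩
  have hmem : L (t, y) ∈ interior Ω := hsub (by
    rw [← closedBall_prod_same]
    refine ⟨?_, hy⟩
    rw [Metric.mem_closedBall, Real.dist_eq, abs_le]
    constructor <;> linarith [ht.1, ht.2])
  exact interior_subset hmem

theorem stmt3
    (d : ℕ) (hd : 0 < d) (Ω : Set (EuclideanSpace ℝ (Fin d)))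
    (hΩ : LocallyCompactSpace Ω) (hint : (interior Ω).Nonempty)
    (φ : ℝ → ℝ) (hφ : IsGauge φ)
    (hφ1 : ∃ C : ℝ, ∀ᶠ r in 𝓝[>] (0:ℝ), φ r / r ≤ C) :
    ∀ᶠ f : C(↥Ω, ℝ) in residual C(↥Ω, ℝ),
      dimH {x : EuclideanSpace ℝ (Fin d) | ∃ hx : x ∈ Ω, 0 < lipGauge φ (⇑f) ⟨x, hx⟩}
          = ((d - 1 : ℕ) : ℝ≥0∞) ∧
      lpdim {x : EuclideanSpace ℝ (Fin d) | ∃ hx : x ∈ Ω, 0 < lipGauge φ (⇑f) ⟨x, hx⟩}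
          = ((d - 1 : ℕ) : EReal) ∧
      dimH {x : EuclideanSpace ℝ (Fin d) | ∃ hx : x ∈ Ω, lipGauge φ (⇑f) ⟨x, hx⟩ = ⊤}
          = ((d - 1 : ℕ) : ℝ≥0∞) ∧
      lpdim {x : EuclideanSpace ℝ (Fin d) | ∃ hx : x ∈ Ω, lipGauge φ (⇑f) ⟨x, hx⟩ = ⊤}
          = ((d - 1 : ℕ) : EReal) := by
  obtain ⟨m, rfl⟩ : ∃ m, d = m + 1 := ⟨d - 1, by omega⟩
  rw [Nat.add_sub_cancel]
  have hφpos : ∀ r, 0 < r → 0 < φ r := fun r hr => hφ.2.2.2 r hr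
  let K : CompactExhaustion Ω := default
  obtain ⟨α, ρ, c, hρ, hbox⟩ := exists_closed_box_subset hint
  let Q : Set Ω := {x | ∃ t ∈ Icc α (α + ρ), ∃ y ∈ Metric.closedBall c ρ, linePoint y t = x.1}
  have hQ : IsCompact Q := by
    rw [Subtype.isCompact_iff]
    have himage : (↑) '' Q = (fun q : ℝ × (Fin m → ℝ) => linePoint q.2 q.1) ''
        (Icc α (α + ρ) ×ˢ Metric.closedBall c ρ) := by
      ext x
      constructor
      · rintro ⟨z, ⟨t, ht, y, hy, hz⟩, rfl⟩
        exact ⟨(t, y), ⟨ht, hy⟩, hz⟩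
      · rintro ⟨⟨t, y⟩, ⟨ht, hy⟩, rfl⟩
        exact ⟨⟨_, hbox t ht y hy⟩, ⟨t, ht, y, hy, rfl⟩, rfl⟩
    rw [himage]
    exact (isCompact_Icc.prod (isCompact_closedBall c ρ)).image continuous_uncurry_linePoint
  obtain ⟨k₀, hk₀⟩ := K.exists_superset_of_isCompact hQ
  have hcell : ∀ᶠ f : C(↥Ω, ℝ) in residual C(↥Ω, ℝ), ∀ k, ∃ p N : ℕ, k + m < p ∧ 0 < N ∧
      gridConst m (k + 1) p ^ (k + 1) + 2 + k ≤ N ∧ ∀ x ∈ K k, ∀ y ∈ K k,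
        SameCell (1 / (p : ℝ)) (1 / ((p : ℝ) * N)) x.1.ofLp y.1.ofLp →
          |f x - f y| < min (φ (1 / ((p : ℝ) * N))) (1 / p) / (k + 1) := by
    refine eventually_countable_forall.2 fun k => residual_sameCell (K.isCompact k) (k + m)
      (fun p => gridConst m (k + 1) p ^ (k + 1) + 2 + k)
      (fun p N => min (φ (1 / ((p : ℝ) * N))) (1 / p) / (k + 1)) fun p N hp hN => ?_
    have hp' : (0 : ℝ) < p := by exact_mod_cast hp
    have hN' : (0 : ℝ) < N := by exact_mod_cast hN
    have := hφpos (1 / ((p : ℝ) * N)) (by positivity)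
    positivity
  filter_upwards [hcell, residual_rising hQ α hρ] with f hf ⟨b, hαb, hbρ, hb⟩
  choose p N hp _ hN hfpN using hf
  have hlow : ∀ y ∈ Metric.closedBall c ρ, ∃ t, linePoint y t ∈
      {x : EuclideanSpace ℝ (Fin (m + 1)) | ∃ hx : x ∈ Ω, lipGauge φ (⇑f) ⟨x, hx⟩ = ⊤} := by
    intro y hy
    have hΩ' : ∀ t ∈ Icc α (α + ρ), linePoint y t ∈ Ω := fun t ht => hbox t ht y hy
    have hmem : ∀ t (ht : t ∈ Icc α (α + ρ)), (⟨linePoint y t, hΩ' t ht⟩ : Ω) ∈ Q :=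
      fun t ht => ⟨t, ht, y, hy, rfl⟩
    obtain ⟨t, ht, htop⟩ := exists_lipGauge_eq_top_on_line hφpos hφ1 f.continuous hΩ'
      (K := fun k => K k) (p := p) (N := N)
      ((eventually_ge_atTop k₀).mono fun k hk t ht => K.subset hk (hk₀ (hmem t ht)))
      (fun k => by have := hp k; omega) (fun k => by have := hN k; omega)
      (fun k x hx z hz hxz => (hfpN k x hx z hz hxz).trans_le
        (by gcongr; exact min_le_right _ _)) hαb hbρ
      (hb _ (hmem α ⟨le_rfl, hαb.trans hbρ⟩) _ (hmem b ⟨hαb, hbρ⟩) rfl rfl fun i => rfl)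
    exact ⟨t, hΩ' t ht, htop⟩
  have hne : {x : EuclideanSpace ℝ (Fin (m + 1)) |
      ∃ hx : x ∈ Ω, lipGauge φ (⇑f) ⟨x, hx⟩ = ⊤}.Nonempty := by
    obtain ⟨t, ht⟩ := hlow c (Metric.mem_closedBall_self hρ.le)
    exact ⟨_, ht⟩
  have hsub : {x : EuclideanSpace ℝ (Fin (m + 1)) | ∃ hx : x ∈ Ω, lipGauge φ (⇑f) ⟨x, hx⟩ = ⊤} ⊆
      {x | ∃ hx : x ∈ Ω, 0 < lipGauge φ (⇑f) ⟨x, hx⟩} := by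
    rintro x ⟨hx, htop⟩
    exact ⟨hx, by rw [htop]; exact ENNReal.zero_lt_top⟩
  have hpack := lpdim_lipGauge_pos_le K hφpos (f := f) hp (fun k => by have := hN k; omega)
    fun k x hx z hz hxz => (hfpN k x hx z hz hxz).trans_le (by gcongr; exact min_le_left _ _)
  have hdim := le_dimH_of_forall_line
    ⟨c, Metric.ball_subset_interior_closedBall (Metric.mem_ball_self hρ)⟩ hlow
  have hpack' := (lpdim_mono hsub).trans hpack
  exact ⟨(dimH_le_of_lpdim_le hpack).antisymm (hdim.trans (dimH_mono hsub)),
    hpack.antisymm ((le_lpdim_of_le_dimH hne hdim).trans (lpdim_mono hsub)),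
    (dimH_le_of_lpdim_le hpack').antisymm hdim, hpack'.antisymm (le_lpdim_of_le_dimH hne hdim)⟩
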